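/- arXiv:1912.10865 — 3 statements merged into one kernel-verified Lean document; each statement's English description precedes it below -/
import Mathlib

section
/- Let k be an algebraically closed field of characteristic 0, let p be a prime number, and let n be a positive integer with p > n + 1. Then every finite p-subgroup G of the general linear group GL(n, k) is abelian and can be generated by at most n elements. -/
open Module

theorem Module.End.isSemisimple_of_pow_eq_one {k V : Type*} [Field k] [CharZero k]
    [AddCommGroup V] [Module k V] {f : Module.End k V} {m : ℕ} (hm : m ≠ 0) (hf : f ^ m = 1) :
    f.IsSemisimple := by
  have hsep : (Polynomial.X ^ m - 1 : Polynomial k).Separable :=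
    Polynomial.X_pow_sub_one_separable_iff.mpr (Nat.cast_ne_zero.mpr hm)
  exact Module.End.isSemisimple_of_squarefree_aeval_eq_zero hsep.squarefree (by simp [hf])

theorem Module.End.maxGenEigenspace_eq_eigenspace_of_pow_eq_one {k V : Type*} [Field k]
    [CharZero k] [AddCommGroup V] [Module k V] [FiniteDimensional k V] {f : Module.End k V}
    {m : ℕ} (hm : m ≠ 0) (hf : f ^ m = 1) (μ : k) :
    f.maxGenEigenspace μ = f.eigenspace μ :=
  (Module.End.isFinitelySemisimple_iff_isSemisimple.mpr
    (isSemisimple_of_pow_eq_one hm hf)).maxGenEigenspace_eq_eigenspace μ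

/-- If `x` and `y` commute up to an operator `z` that commutes with both, then comparing
determinants on an eigenspace of `z` shows that its eigenvalue is a root of unity of order
dividing the dimension of that eigenspace. -/
theorem Module.End.pow_finrank_eigenspace_eq_one {k V : Type*} [Field k]
    [AddCommGroup V] [Module k V] [FiniteDimensional k V] {x y z : Module.End k V}
    (hx : IsUnit x) (hy : IsUnit y) (hxy : x * y = z * (y * x))
    (hzx : Commute z x) (hzy : Commute z y) (μ : k) :
    μ ^ finrank k (z.eigenspace μ) = 1 := by
  have hxE : ∀ v ∈ z.eigenspace μ, x v ∈ z.eigenspace μ :=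
    mapsTo_genEigenspace_of_comm hzx μ 1
  have hyE : ∀ v ∈ z.eigenspace μ, y v ∈ z.eigenspace μ :=
    mapsTo_genEigenspace_of_comm hzy μ 1
  have isUnit_restrict : ∀ w : Module.End k V, IsUnit w →
      ∀ h : ∀ v ∈ z.eigenspace μ, w v ∈ z.eigenspace μ, IsUnit (LinearMap.det (w.restrict h)) := by
    intro w hw h
    refine LinearMap.isUnit_det _ ((LinearMap.isUnit_iff_ker_eq_bot _).mpr ?_)
    rw [LinearMap.ker_eq_bot]
    intro a b hab
    have hinj : Function.Injective w :=
      LinearMap.ker_eq_bot.mp ((LinearMap.isUnit_iff_ker_eq_bot w).mp hw)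
    exact Subtype.ext (hinj (congrArg Subtype.val hab))
  have key : x.restrict hxE * y.restrict hyE = μ • (y.restrict hyE * x.restrict hxE) := by
    ext v
    have h1 : x (y v) = z (y (x v)) := LinearMap.congr_fun hxy (v : V)
    have h2 : z (y (x v)) = μ • y (x v) := mem_eigenspace_iff.mp (hyE _ (hxE _ v.2))
    exact h1.trans h2
  have hdet := congrArg LinearMap.det key
  rw [LinearMap.det_smul, map_mul, map_mul, mul_comm (LinearMap.det (y.restrict hyE))] at hdet
  have hu := (isUnit_restrict x hx hxE).mul (isUnit_restrict y hy hyE)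
  exact (mul_eq_right₀ hu.ne_zero).mp hdet.symm

theorem Module.End.eq_one_of_mul_eq_mul_mul {k V : Type*} [Field k] [IsAlgClosed k] [CharZero k]
    [AddCommGroup V] [Module k V] [FiniteDimensional k V] {x y z : Module.End k V}
    (hx : IsUnit x) (hy : IsUnit y) (hxy : x * y = z * (y * x))
    (hzx : Commute z x) (hzy : Commute z y) {p m : ℕ} (hp : p.Prime)
    (hz : z ^ p ^ m = 1) (hV : finrank k V < p) : z = 1 := by
  have hpm : p ^ m ≠ 0 := pow_ne_zero _ hp.ne_zero
  have eigenvalue_eq_one : ∀ μ, z.eigenspace μ ≠ ⊥ → μ = 1 := by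
    intro μ hμ
    obtain ⟨v, hv, hv0⟩ := Submodule.exists_mem_ne_zero_of_ne_bot hμ
    have hμp : μ ^ p ^ m = 1 := by
      have h := (show z.HasEigenvector μ v from ⟨hv, hv0⟩).pow_apply (p ^ m)
      rw [hz, Module.End.one_apply] at h
      exact smul_left_injective k hv0 (by simpa using h.symm)
    have hpos : 0 < finrank k (z.eigenspace μ) :=
      Nat.pos_of_ne_zero fun h => hμ (Submodule.finrank_eq_zero.mp h)
    have hlt : finrank k (z.eigenspace μ) < p := (Submodule.finrank_le _).trans_lt hV
    have hcop : (finrank k (z.eigenspace μ)).gcd (p ^ m) = 1 :=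
      (Nat.coprime_of_lt_prime hpos.ne' hlt hp).symm.pow_right m |>.gcd_eq_one
    simpa [hcop] using
      pow_gcd_eq_one.mpr ⟨pow_finrank_eigenspace_eq_one hx hy hxy hzx hzy μ, hμp⟩
  have htop : z.eigenspace 1 = ⊤ := by
    rw [eq_top_iff, ← iSup_maxGenEigenspace_eq_top z]
    refine iSup_le fun μ => ?_
    rw [maxGenEigenspace_eq_eigenspace_of_pow_eq_one hpm hz]
    by_cases hμ : z.eigenspace μ = ⊥
    · simp [hμ]
    · rw [eigenvalue_eq_one μ hμ]
  ext v
  have hv : v ∈ z.eigenspace 1 := htop ▸ Submodule.mem_top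
  simpa using mem_eigenspace_iff.mp hv

theorem IsPGroup.mul_comm_of_commutator_mem_center {G : Type*} [Group G] [Finite G] {p : ℕ}
    [Fact p.Prime] (hG : IsPGroup p G)
    (h : ∀ x y : G, x * y * x⁻¹ * y⁻¹ ∈ Subgroup.center G → x * y = y * x) (a b : G) :
    a * b = b * a := by
  suffices Subgroup.center G = ⊤ from
    (Subgroup.mem_center_iff.mp (this ▸ Subgroup.mem_top b) a)
  by_contra hne
  have : Nontrivial (G ⧸ Subgroup.center G) := QuotientGroup.nontrivial_iff.mpr hne
  have := (hG.to_quotient (Subgroup.center G)).center_nontrivial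
  obtain ⟨⟨q, hq⟩, hq1⟩ := exists_ne (1 : Subgroup.center (G ⧸ Subgroup.center G))
  obtain ⟨x, rfl⟩ := QuotientGroup.mk_surjective q
  refine hq1 (Subtype.ext ((QuotientGroup.eq_one_iff x).mpr (Subgroup.mem_center_iff.mpr ?_)))
  intro y
  refine (h x y ((QuotientGroup.eq_one_iff _).mp ?_)).symm
  have hxy := Subgroup.mem_center_iff.mp hq (y : G ⧸ Subgroup.center G)
  simp [← hxy]

theorem Representation.mul_comm_of_isPGroup {k G V : Type*} [Field k] [IsAlgClosed k]
    [CharZero k] [AddCommGroup V] [Module k V] [FiniteDimensional k V] [Group G] [Finite G]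
    (ρ : Representation k G V) (hρ : Function.Injective ρ) {p : ℕ} [Fact p.Prime]
    (hG : IsPGroup p G) (hV : finrank k V < p) (a b : G) : a * b = b * a := by
  refine hG.mul_comm_of_commutator_mem_center (fun x y hxy => ?_) a b
  obtain ⟨m, hm⟩ := hG (x * y * x⁻¹ * y⁻¹)
  have hcomm : ∀ g, Commute (ρ (x * y * x⁻¹ * y⁻¹)) (ρ g) := fun g =>
    Commute.map (Subgroup.mem_center_iff.mp hxy g).symm ρ
  have h1 : ρ (x * y * x⁻¹ * y⁻¹) = 1 :=
    Module.End.eq_one_of_mul_eq_mul_mul ((Group.isUnit x).map ρ) ((Group.isUnit y).map ρ)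
      (by simp only [← map_mul]; congr 1; group) (hcomm x) (hcomm y) Fact.out
      (by rw [← map_pow, hm, map_one]) hV
  have h2 : x * y * x⁻¹ * y⁻¹ = 1 := hρ (h1.trans (map_one ρ).symm)
  simpa [mul_inv_eq_one, mul_inv_eq_iff_eq_mul] using h2

theorem Representation.exists_common_eigenvector {k G V : Type*} [Field k] [IsAlgClosed k]
    [CharZero k] [AddCommGroup V] [Module k V] [FiniteDimensional k V] [Nontrivial V]
    [CommGroup G] [Finite G] (ρ : Representation k G V) :
    ∃ (v : V) (χ : G →* kˣ), v ≠ 0 ∧ ∀ g, ρ g v = (χ g : k) • v := by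
  have hsup := Module.End.iSup_iInf_maxGenEigenspace_eq_top_of_iSup_maxGenEigenspace_eq_top_of_commute
    (fun g => ρ g) (fun g h _ => (Commute.all g h).map ρ)
    (fun g => Module.End.iSup_maxGenEigenspace_eq_top (ρ g))
  obtain ⟨χ, hχ⟩ : ∃ χ : G → k, ⨅ g, Module.End.maxGenEigenspace (ρ g) (χ g) ≠ ⊥ := by
    by_contra! h
    simp [h] at hsup
  obtain ⟨v, hv, hv0⟩ := Submodule.exists_mem_ne_zero_of_ne_bot hχ
  have hmul : ∀ g, ρ g v = χ g • v := by
    intro g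
    have hg : ρ g ^ Nat.card G = 1 := by rw [← map_pow, pow_card_eq_one', map_one]
    have := (Submodule.mem_iInf _).mp hv g
    rw [Module.End.maxGenEigenspace_eq_eigenspace_of_pow_eq_one Nat.card_pos.ne' hg] at this
    exact Module.End.mem_eigenspace_iff.mp this
  have hinj := smul_left_injective k hv0
  let χ' : G →* k :=
    { toFun := χ
      map_one' := hinj (by simp [← hmul])
      map_mul' := fun g h => hinj <| by
        simp only [← hmul, map_mul, Module.End.mul_apply]
        rw [hmul h, map_smul, hmul g, smul_smul, mul_comm] }
  exact ⟨v, χ'.toHomUnits, hv0, hmul⟩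

/-- A generating set of the kernel of a homomorphism with cyclic image, together with one further
element, generates the whole group. -/
theorem MonoidHom.exists_closure_eq_top_of_isCyclic_range {G H : Type*} [Group G] [Group H]
    (χ : G →* H) [IsCyclic χ.range] (T : Finset χ.ker)
    (hT : Subgroup.closure (T : Set χ.ker) = ⊤) :
    ∃ S : Finset G, S.card ≤ T.card + 1 ∧ Subgroup.closure (S : Set G) = ⊤ := by
  classical
  obtain ⟨⟨_, g₀, rfl⟩, hg₀⟩ := IsCyclic.exists_generator (α := χ.range)
  refine ⟨insert g₀ (T.image Subtype.val),
    (Finset.card_insert_le _ _).trans (Nat.add_le_add_right Finset.card_image_le 1), ?_⟩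
  set C := Subgroup.closure ((insert g₀ (T.image Subtype.val) : Finset G) : Set G) with hC
  have hker : χ.ker ≤ C := by
    have h := congrArg (Subgroup.map χ.ker.subtype) hT
    rw [MonoidHom.map_closure, ← MonoidHom.range_eq_map, Subgroup.range_subtype] at h
    rw [← h]
    refine Subgroup.closure_mono ?_
    simp
  have hg₀C : g₀ ∈ C := Subgroup.subset_closure (by simp)
  refine (Subgroup.eq_top_iff' C).mpr fun g => ?_
  obtain ⟨j, hj⟩ := Subgroup.mem_zpowers_iff.mp (hg₀ ⟨χ g, g, rfl⟩)
  have hj' : χ g₀ ^ j = χ g := congrArg Subtype.val hj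
  have hmem : g * (g₀ ^ j)⁻¹ ∈ χ.ker := by simp [MonoidHom.mem_ker, hj']
  simpa using C.mul_mem (hker hmem) (C.zpow_mem hg₀C j)

/-- A linear operator of finite order in characteristic zero that fixes a vector `v` and induces
the identity modulo `v` is the identity. -/
theorem Module.End.eq_one_of_pow_eq_one_of_sub_mem_span {k V : Type*} [Field k] [CharZero k]
    [AddCommGroup V] [Module k V] {f : Module.End k V} {v : V} (hfv : f v = v)
    (hf : ∀ w, f w - w ∈ Submodule.span k {v}) {m : ℕ} (hm : m ≠ 0) (hfm : f ^ m = 1) :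
    f = 1 := by
  ext w
  obtain ⟨c, hc⟩ := Submodule.mem_span_singleton.mp (hf w)
  have hfix : f (c • v) = c • v := by rw [map_smul, hfv]
  have hw : f w = w + c • v := by rw [hc]; abel
  have hpow : ∀ i : ℕ, (f ^ i) w = w + i • (c • v) := by
    intro i
    induction i with
    | zero => simp
    | succ i ih =>
      rw [pow_succ', Module.End.mul_apply, ih, map_add, map_nsmul, hfix, hw, succ_nsmul]
      abel
  have h := hpow m
  rw [hfm, Module.End.one_apply, left_eq_add, ← Nat.cast_smul_eq_nsmul k,
    smul_eq_zero_iff_right (Nat.cast_ne_zero.mpr hm)] at h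
  rw [hw, h, add_zero, Module.End.one_apply]

theorem Representation.exists_closure_eq_top_of_commGroup {k : Type*} [Field k] [IsAlgClosed k]
    [CharZero k] (n : ℕ) {G V : Type*} [AddCommGroup V] [Module k V] [FiniteDimensional k V]
    [CommGroup G] [Finite G] (ρ : Representation k G V) (hρ : Function.Injective ρ)
    (hn : finrank k V = n) :
    ∃ S : Finset G, S.card ≤ n ∧ Subgroup.closure (S : Set G) = ⊤ := by
  induction n generalizing G V with
  | zero =>
    have : Subsingleton V := finrank_zero_iff.mp hn
    have : Subsingleton G := ⟨fun a b => hρ (Subsingleton.elim _ _)⟩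
    exact ⟨∅, by simp, Subsingleton.elim _ _⟩
  | succ n ih =>
    have : Nontrivial V := nontrivial_of_finrank_pos (R := k) (by omega)
    obtain ⟨v, χ, hv0, hv⟩ := ρ.exists_common_eigenvector
    have hfix : ∀ h : χ.ker, ρ h v = v := fun h => by
      rw [hv, MonoidHom.mem_ker.mp h.2, Units.val_one, one_smul]
    let W := Submodule.span k {v}
    let ρ₁ : Representation k χ.ker V := ρ.comp χ.ker.subtype
    have hW : ∀ h, W ≤ W.comap (ρ₁ h) := fun h => by
      rw [Submodule.span_singleton_le_iff_mem, Submodule.mem_comap]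
      exact (hfix h).symm ▸ Submodule.mem_span_singleton_self v
    have hinj : Function.Injective (ρ₁.quotient W hW) := by
      rw [injective_iff_map_eq_one]
      intro h hh
      refine Subtype.ext (hρ ?_)
      rw [Subgroup.coe_one, map_one]
      refine Module.End.eq_one_of_pow_eq_one_of_sub_mem_span (hfix h) (fun w => ?_)
        (Nat.card_pos (α := G)).ne' (by rw [← map_pow, pow_card_eq_one', map_one])
      exact (Submodule.Quotient.eq W).mp (LinearMap.congr_fun hh (W.mkQ w))
    have hfin : finrank k (V ⧸ W) = n := by
      have h1 := Submodule.finrank_quotient_add_finrank W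
      rw [finrank_span_singleton hv0] at h1
      omega
    obtain ⟨T, hTn, hT⟩ := ih (ρ₁.quotient W hW) hinj hfin
    have : Finite χ.range := Set.finite_range χ
    obtain ⟨S, hS, hS'⟩ := χ.exists_closure_eq_top_of_isCyclic_range T hT
    exact ⟨S, hS.trans (by omega), hS'⟩


/-- Let `k` be an algebraically closed field of characteristic `0`, let `p` be a prime
number, and let `n` be a positive integer with `p > n + 1`. Then every finite `p`-subgroup
`G` of `GL(n, k)` is abelian and can be generated by at most `n` elements. -/
theorem finite_p_subgroup_GL_abelian_rank_le
    {k : Type*} [Field k] [IsAlgClosed k] [CharZero k]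
    (p n : ℕ) (hp : p.Prime) (hn : 0 < n) (hpn : n + 1 < p)
    (G : Subgroup (Matrix.GeneralLinearGroup (Fin n) k)) [Finite G]
    (hG : IsPGroup p G) :
    (∀ a b : G, a * b = b * a) ∧
      ∃ S : Finset G, S.card ≤ n ∧ Subgroup.closure (S : Set G) = ⊤ := by
  have : Fact p.Prime := ⟨hp⟩
  let ρ : Representation k G (Fin n → k) :=
    ((Matrix.toLinAlgEquiv' : Matrix (Fin n) (Fin n) k ≃ₐ[k] _) : _ →* _).comp
      ((Units.coeHom _).comp G.subtype)
  have hρ : Function.Injective ρ :=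
    Matrix.toLinAlgEquiv'.injective.comp (Units.val_injective.comp Subtype.val_injective)
  have hcomm : ∀ a b : G, a * b = b * a :=
    ρ.mul_comm_of_isPGroup hρ hG (by rw [finrank_fin_fun]; omega)
  let : CommGroup G := { (inferInstance : Group G) with mul_comm := hcomm }
  exact ⟨hcomm, ρ.exists_closure_eq_top_of_commGroup n hρ (finrank_fin_fun k)⟩
end

section
/- Let k be an algebraically closed field of characteristic 0 and let G be a finite abelian subgroup of GL(n, k). Then G can be generated by at most n elements. -/
open Module in
/-- An element of finite order in the endomorphism algebra of a finite-dimensional space over a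
field of characteristic zero is semisimple. -/
lemma IsOfFinOrder.isSemisimple_end {k V : Type*} [Field k] [CharZero k] [AddCommGroup V]
    [Module k V] {f : End k V} (hf : IsOfFinOrder f) : f.IsSemisimple := by
  have hsep : (Polynomial.X ^ orderOf f - 1 : Polynomial k).Separable :=
    Polynomial.X_pow_sub_one_separable_iff.2 (by exact_mod_cast hf.orderOf_pos.ne')
  exact End.isSemisimple_of_squarefree_aeval_eq_zero hsep.squarefree
    (by simp [pow_orderOf_eq_one])

/-- A finite group with a family of homomorphisms to an integral domain, indexed by a finset `s`,
is generated by at most `#s` elements together with the intersection of the kernels. -/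
lemma exists_card_le_closure_sup_iInf_ker_eq_top {G R ι : Type*} [Group G] [Finite G]
    [CommRing R] [IsDomain R] (f : ι → G →* R) (s : Finset ι) :
    ∃ S : Finset G, S.card ≤ s.card ∧
      Subgroup.closure (S : Set G) ⊔ ⨅ i ∈ s, (f i).ker = ⊤ := by
  classical
  induction s using Finset.induction_on with
  | empty => exact ⟨∅, by simp⟩
  | insert j s hj ih =>
    obtain ⟨S, hcard, hS⟩ := ih
    set K : Subgroup G := ⨅ i ∈ s, (f i).ker
    let φ : K →* Rˣ := (f j).toHomUnits.comp K.subtype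
    have : Finite φ.range := Finite.of_surjective _ φ.rangeRestrict_surjective
    obtain ⟨⟨_, g, rfl⟩, hg⟩ := IsCyclic.exists_generator (α := φ.range)
    refine ⟨insert (g : G) S, ?_, ?_⟩
    · rw [Finset.card_insert_of_notMem hj]
      exact (Finset.card_insert_le _ _).trans (by lia)
    · rw [Finset.iInf_insert, eq_top_iff, ← hS, Finset.coe_insert]
      refine sup_le ((Subgroup.closure_mono (Set.subset_insert _ _)).trans le_sup_left) ?_
      intro x hx
      obtain ⟨n, hn⟩ := Subgroup.mem_zpowers_iff.1 (hg ⟨φ ⟨x, hx⟩, _, rfl⟩)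
      have hn' : φ g ^ n = φ ⟨x, hx⟩ := congrArg Subtype.val hn
      have hker : φ (g ^ (-n) * ⟨x, hx⟩) = 1 := by
        rw [map_mul, map_zpow, ← hn', zpow_neg, inv_mul_cancel]
      have hfix : f j ((g : G) ^ (-n) * x) = 1 := congrArg Units.val hker
      rw [show x = (g : G) ^ n * ((g : G) ^ (-n) * x) by group]
      refine mul_mem (Subgroup.mem_sup_left (zpow_mem (Subgroup.subset_closure (by simp)) n))
        (Subgroup.mem_sup_right ⟨hfix, ?_⟩)
      exact mul_mem (zpow_mem g.2 _) hx

open Module in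
/-- A finite abelian group with a faithful representation of dimension `d` over an algebraically
closed field of characteristic zero is generated by at most `d` elements. -/
lemma exists_card_le_finrank_closure_eq_top {k V G : Type*} [Field k] [IsAlgClosed k] [CharZero k]
    [AddCommGroup V] [Module k V] [FiniteDimensional k V] [Group G] [Finite G]
    (hab : ∀ a b : G, a * b = b * a) (ρ : G →* End k V) (hρ : Function.Injective ρ) :
    ∃ S : Finset G, S.card ≤ finrank k V ∧ Subgroup.closure (S : Set G) = ⊤ := by
  have hcomm (a b : G) : Commute (ρ a) (ρ b) := by
    rw [Commute, SemiconjBy, ← map_mul, hab, map_mul]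
  let W (χ : G → k) : Submodule k V := ⨅ g, (ρ g).maxGenEigenspace (χ g)
  have hmem {χ : G → k} {v : V} (hv : v ∈ W χ) (g : G) : ρ g v = χ g • v := by
    have hss : (ρ g).IsSemisimple := (ρ.isOfFinOrder (isOfFinOrder_of_finite g)).isSemisimple_end
    have := (Submodule.mem_iInf _).1 hv g
    rwa [hss.isFinitelySemisimple.maxGenEigenspace_eq_eigenspace, End.mem_eigenspace_iff] at this
  have hindep : iSupIndep W :=
    End.independent_iInf_maxGenEigenspace_of_forall_mapsTo _
      fun i j ↦ End.mapsTo_maxGenEigenspace_of_comm (hcomm j i)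
  have htop : ⨆ χ, W χ = ⊤ :=
    End.iSup_iInf_maxGenEigenspace_eq_top_of_iSup_maxGenEigenspace_eq_top_of_commute _
      (fun i j _ ↦ hcomm i j) fun i ↦ End.iSup_maxGenEigenspace_eq_top (ρ i)
  have hchar (χ : {χ // W χ ≠ ⊥}) : ∃ f : G →* k, ∀ g, f g = χ.1 g := by
    obtain ⟨v, hv, hv0⟩ := (Submodule.ne_bot_iff _).1 χ.2
    refine ⟨⟨⟨χ.1, ?_⟩, fun a b ↦ ?_⟩, fun _ ↦ rfl⟩
    · refine smul_left_injective k hv0 ?_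
      simp [← hmem hv]
    · refine smul_left_injective k hv0 ?_
      simp only [← hmem hv, map_mul, End.mul_apply, mul_smul]
      rw [hmem hv b, map_smul, hmem hv a, smul_comm]
  choose f hf using hchar
  let := hindep.fintypeNeBotOfFiniteDimensional
  obtain ⟨S, hcard, hS⟩ := exists_card_le_closure_sup_iInf_ker_eq_top f Finset.univ
  refine ⟨S, hcard.trans hindep.subtype_ne_bot_le_finrank, ?_⟩
  suffices hker : ⨅ χ ∈ Finset.univ, (f χ).ker = ⊥ by rwa [hker, sup_bot_eq] at hS
  refine (Subgroup.eq_bot_iff_forall _).2 fun g hg ↦ hρ ?_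
  have hg' (χ : {χ // W χ ≠ ⊥}) : χ.1 g = 1 := by
    rw [← hf]
    simpa [Subgroup.mem_iInf] using Subgroup.mem_iInf.1 (Subgroup.mem_iInf.1 hg χ)
  rw [map_one, ← sub_eq_zero, ← LinearMap.ker_eq_top, eq_top_iff, ← htop]
  refine iSup_le fun χ v hv ↦ ?_
  by_cases hχ : W χ = ⊥
  · rw [hχ, Submodule.mem_bot] at hv
    simp [hv]
  · have hχg : χ g = 1 := hg' ⟨χ, hχ⟩
    simp [hmem hv, hχg]

/-- Let `k` be an algebraically closed field of characteristic `0` and let `G` be a finite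
abelian subgroup of `GL(n, k)`. Then `G` can be generated by at most `n` elements. -/
theorem finite_abelian_subgroup_GL_rank_le
    {k : Type*} [Field k] [IsAlgClosed k] [CharZero k] (n : ℕ)
    (G : Subgroup (Matrix.GeneralLinearGroup (Fin n) k)) [Finite G]
    (hab : ∀ a b : G, a * b = b * a) :
    ∃ S : Finset G, S.card ≤ n ∧ Subgroup.closure (S : Set G) = ⊤ := by
  let ρ : G →* Module.End k (Fin n → k) :=
    (Matrix.toLinAlgEquiv' : Matrix (Fin n) (Fin n) k ≃ₐ[k] _).toMonoidHom.comp
      ((Units.coeHom _).comp G.subtype)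
  have hρ : Function.Injective ρ :=
    Matrix.toLinAlgEquiv'.injective.comp (Units.val_injective.comp G.subtype_injective)
  simpa using exists_card_le_finrank_closure_eq_top hab ρ hρ
end

section
/- Let k be a field of characteristic 0, let p be a prime number, and let r and n be positive integers. If there exists an injective group homomorphism from the elementary abelian group (ℤ/pℤ)^r into GL(n, k), then r ≤ n. -/
/-- A family of distinct commuting endomorphisms with `f i ^ m = 1`, over an algebraically closed
field in which `m` is invertible, has at most `m ^ finrank K V` members: each is determined
by its eigenvalues, which are `m`-th roots of unity, on the joint eigenspaces. -/
theorem Module.End.card_le_pow_finrank_of_commute_of_pow_eq_one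
    {K V ι : Type*} [Field K] [IsAlgClosed K] [AddCommGroup V] [Module K V] [FiniteDimensional K V]
    {m : ℕ} (hm : (m : K) ≠ 0) (f : ι → Module.End K V) (hf : Function.Injective f)
    (hcomm : ∀ i j, Commute (f i) (f j)) (hpow : ∀ i, f i ^ m = 1) :
    Nat.card ι ≤ m ^ Module.finrank K V := by
  classical
  have hm0 : 0 < m := Nat.pos_of_ne_zero fun h ↦ hm (by simp [h])
  have hss (i : ι) : (f i).IsSemisimple :=
    Module.End.isSemisimple_of_squarefree_aeval_eq_zero
      (Polynomial.X_pow_sub_one_separable_iff.mpr hm).squarefree (by simp [hpow i])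
  let W (χ : ι → K) : Submodule K V := ⨅ i, (f i).maxGenEigenspace (χ i)
  have hW (χ : ι → K) {v : V} (hv : v ∈ W χ) (i : ι) : f i v = χ i • v := by
    have h := (Submodule.mem_iInf _).mp hv i
    rwa [(hss i).isFinitelySemisimple.maxGenEigenspace_eq_eigenspace,
      Module.End.mem_eigenspace_iff] at h
  have htop : ⨆ χ, W χ = ⊤ :=
    Module.End.iSup_iInf_maxGenEigenspace_eq_top_of_iSup_maxGenEigenspace_eq_top_of_commute f
      (fun i j _ ↦ hcomm i j) fun i ↦ Module.End.iSup_maxGenEigenspace_eq_top (f i)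
  have hind : iSupIndep W :=
    Module.End.independent_iInf_maxGenEigenspace_of_forall_mapsTo f fun i j μ ↦
      Module.End.mapsTo_maxGenEigenspace_of_comm (hcomm j i) μ
  let _ := hind.fintypeNeBotOfFiniteDimensional
  have hroot (i : ι) (χ : {χ // W χ ≠ ⊥}) : χ.1 i ∈ Polynomial.nthRootsFinset m (1 : K) := by
    obtain ⟨v, hv, hv0⟩ := (Submodule.ne_bot_iff _).mp χ.2
    have h : ∀ n : ℕ, (f i ^ n) v = χ.1 i ^ n • v := by
      intro n
      induction n with
      | zero => simp
      | succ n ih => rw [pow_succ', Module.End.mul_apply, ih, map_smul, hW _ hv, smul_smul, pow_succ]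
    have h1 := h m
    rw [hpow, Module.End.one_apply] at h1
    rw [Polynomial.mem_nthRootsFinset hm0]
    exact smul_left_injective K hv0 (by simpa using h1.symm)
  let e (i : ι) (χ : {χ // W χ ≠ ⊥}) : Polynomial.nthRootsFinset m (1 : K) := ⟨χ.1 i, hroot i χ⟩
  have he : Function.Injective e := by
    intro i j hij
    apply hf
    rw [← LinearMap.eqLocus_eq_top, eq_top_iff, ← htop, iSup_le_iff]
    intro χ v hv
    by_cases hχ : W χ = ⊥
    · rw [hχ, Submodule.mem_bot] at hv
      simp [hv]
    · have h : χ i = χ j := congrArg Subtype.val (congrFun hij ⟨χ, hχ⟩)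
      rw [LinearMap.mem_eqLocus, hW χ hv, hW χ hv, h]
  calc Nat.card ι ≤ Nat.card ({χ // W χ ≠ ⊥} → Polynomial.nthRootsFinset m (1 : K)) :=
        Nat.card_le_card_of_injective e he
    _ = (Polynomial.nthRootsFinset m (1 : K)).card ^ Fintype.card {χ // W χ ≠ ⊥} := by
        simp [Nat.card_eq_fintype_card]
    _ ≤ m ^ Fintype.card {χ // W χ ≠ ⊥} := by
        gcongr
        exact (Multiset.toFinset_card_le _).trans (Polynomial.card_nthRoots m 1)
    _ ≤ m ^ Module.finrank K V :=
        Nat.pow_le_pow_right hm0 hind.subtype_ne_bot_le_finrank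

/-- Let `k` be a field of characteristic `0`, let `p` be a prime number, and let `r` and
`n` be positive integers. If there exists an injective group homomorphism from the
elementary abelian group `(ℤ/pℤ)^r` into `GL(n, k)`, then `r ≤ n`. -/
theorem elementary_abelian_in_GL_rank_le
    {k : Type*} [Field k] [CharZero k]
    (p : ℕ) (hp : p.Prime) (r n : ℕ) (hr : 0 < r) (hn : 0 < n)
    (φ : (Fin r → Multiplicative (ZMod p)) →* Matrix.GeneralLinearGroup (Fin n) k)
    (hφ : Function.Injective φ) :
    r ≤ n := by
  have : Fact p.Prime := ⟨hp⟩
  let ψ : (Fin r → Multiplicative (ZMod p)) →* Module.End (AlgebraicClosure k)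
      (Fin n → AlgebraicClosure k) :=
    (Matrix.toLinAlgEquiv' (R := AlgebraicClosure k) (n := Fin n) : _ →* _).comp
      ((algebraMap k (AlgebraicClosure k)).mapMatrix.toMonoidHom.comp ((Units.coeHom _).comp φ))
  have hψ : Function.Injective ψ :=
    Matrix.toLinAlgEquiv'.injective.comp
      ((Matrix.map_injective (algebraMap k (AlgebraicClosure k)).injective).comp
        (Units.val_injective.comp hφ))
  have hpow (g : Fin r → Multiplicative (ZMod p)) : g ^ p = 1 := by
    ext i
    change p • (g i).toAdd = 0
    simp
  have hcard := Module.End.card_le_pow_finrank_of_commute_of_pow_eq_one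
    (Nat.cast_ne_zero.mpr hp.ne_zero) ψ hψ (fun g h ↦ (Commute.all g h).map ψ)
    fun g ↦ by rw [← map_pow, hpow, map_one]
  simp only [Nat.card_pi, Nat.card_congr Multiplicative.toAdd, Nat.card_zmod,
    Finset.prod_const, Finset.card_univ, Fintype.card_fin, Module.finrank_fin_fun] at hcard
  exact (Nat.pow_le_pow_iff_right hp.one_lt).mp hcard
end
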